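/- For every pair of integers s ≥ 1 and t ≥ 1 there exists an algebraic number field K of degree s + 2t over ℚ admitting exactly s real embeddings and exactly 2t non-real complex embeddings (equivalently, exactly s real places and exactly t complex places). -/

import Mathlib

open Polynomial IntermediateField

theorem Polynomial.card_roots_toFinset_le_iterate_derivative (p : ℝ[X]) (k : ℕ) :
    p.roots.toFinset.card ≤ (derivative^[k] p).roots.toFinset.card + k := by
  induction k generalizing p with
  | zero => simp
  | succ k ih =>
    have h₁ := card_roots_toFinset_le_derivative p
    have h₂ := ih (derivative p)
    rw [Function.iterate_succ_apply]
    omega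

theorem Polynomial.le_card_roots_toFinset_of_eval_mul_eval_neg {p : ℝ[X]} (hp : p ≠ 0)
    {x : ℕ → ℝ} (hx : Monotone x) {k : ℕ}
    (h : ∀ j < k, p.eval (x j) * p.eval (x (j + 1)) < 0) :
    k ≤ p.roots.toFinset.card := by
  have hroot (j : Fin k) : ∃ y ∈ Set.Ioo (x j) (x (j + 1)), p.eval y = 0 := by
    have hle : x j ≤ x (j + 1) := hx (Nat.le_succ _)
    have hj := h j j.2
    have hcont : ContinuousOn (fun y => p.eval y) (Set.Icc (x j) (x (j + 1))) :=
      p.continuous.continuousOn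
    rcases mul_neg_iff.1 hj with ⟨h₁, h₂⟩ | ⟨h₁, h₂⟩
    · exact intermediate_value_Ioo' hle hcont ⟨h₂, h₁⟩
    · exact intermediate_value_Ioo hle hcont ⟨h₁, h₂⟩
  choose y hy hy0 using hroot
  have hmono : StrictMono y := fun i j hij =>
    (hy i).2.trans_le <| (hx (Nat.succ_le_of_lt hij)).trans (hy j).1.le
  calc
    k = (Finset.univ.image y).card := by
      rw [Finset.card_image_of_injective _ hmono.injective, Finset.card_univ, Fintype.card_fin]
    _ ≤ p.roots.toFinset.card := Finset.card_le_card fun z hz => by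
      obtain ⟨j, -, rfl⟩ := Finset.mem_image.1 hz
      simp [hp, hy0 j]

/-- The field embeddings of a simple extension `ℚ⟮α⟯` into `ℂ` with real image correspond to the
real roots of the minimal polynomial of `α`. -/
theorem card_real_embeddings_adjoin_simple {α : ℂ} (hα : IsIntegral ℚ α) :
    Nat.card {φ : ℚ⟮α⟯ →+* ℂ // ∀ x : ℚ⟮α⟯, (φ x).im = 0} =
      ((minpoly ℚ α).aroots ℝ).toFinset.card := by
  rw [← Nat.card_eq_finsetCard]
  have hgen (φ : ℚ⟮α⟯ →+* ℂ) : aeval (φ (AdjoinSimple.gen ℚ α)) (minpoly ℚ α) = 0 := by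
    have h := congrArg φ (aeval_gen_minpoly ℚ α)
    rwa [aeval_def, hom_eval₂, map_zero,
      RingHom.ext_rat (φ.comp _) (algebraMap ℚ ℂ), ← aeval_def] at h
  have hext {φ ψ : ℚ⟮α⟯ →+* ℂ}
      (h : φ (AdjoinSimple.gen ℚ α) = ψ (AdjoinSimple.gen ℚ α)) : φ = ψ := by
    have : φ.toRatAlgHom = ψ.toRatAlgHom := by
      apply adjoin_algHom_ext
      rintro x rfl
      exact h
    ext x
    exact DFunLike.congr_fun this x
  have hofReal (r : ℝ) : aeval (r : ℂ) (minpoly ℚ α) = ((aeval r (minpoly ℚ α) : ℝ) : ℂ) :=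
    aeval_algebraMap_apply ℂ r (minpoly ℚ α)
  have hre (φ : {φ : ℚ⟮α⟯ →+* ℂ // ∀ x : ℚ⟮α⟯, (φ x).im = 0}) :
      (((φ.1 (AdjoinSimple.gen ℚ α)).re : ℝ) : ℂ) = φ.1 (AdjoinSimple.gen ℚ α) :=
    Complex.ext rfl (φ.2 _).symm
  refine Nat.card_eq_of_bijective (fun φ => ⟨(φ.1 (AdjoinSimple.gen ℚ α)).re, ?_⟩) ⟨?_, ?_⟩
  · rw [Multiset.mem_toFinset, mem_aroots]
    refine ⟨minpoly.ne_zero hα, Complex.ofReal_injective ?_⟩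
    rw [← hofReal, hre, hgen, Complex.ofReal_zero]
  · intro φ ψ h
    refine Subtype.ext (hext ?_)
    rw [← hre φ, ← hre ψ]
    exact congrArg _ (congrArg Subtype.val h)
  · rintro ⟨r, hr⟩
    rw [Multiset.mem_toFinset, mem_aroots] at hr
    let φ := (algHomAdjoinIntegralEquiv ℚ hα (K := ℂ)).symm
      ⟨(r : ℂ), mem_aroots.2 ⟨hr.1, by rw [hofReal, hr.2, Complex.ofReal_zero]⟩⟩
    have hφ : φ (AdjoinSimple.gen ℚ α) = r := algHomAdjoinIntegralEquiv_symm_apply_gen ℚ hα _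
    have hconj : (starRingEnd ℂ).comp (φ : ℚ⟮α⟯ →+* ℂ) = φ := hext <| by
      simp [hφ]
    refine ⟨⟨φ, fun x => Complex.conj_eq_iff_im.1 (DFunLike.congr_fun hconj x)⟩, ?_⟩
    exact Subtype.ext (by simp [hφ])

theorem exists_intermediateField_of_irreducible {q : ℚ[X]} (hq : Irreducible q) (hm : q.Monic) :
    ∃ K : IntermediateField ℚ ℂ,
      FiniteDimensional ℚ K ∧
      Module.finrank ℚ K = q.natDegree ∧
      Nat.card {φ : K →+* ℂ // ∀ x : K, (φ x).im = 0} = (q.aroots ℝ).toFinset.card := by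
  obtain ⟨α, hα⟩ := IsAlgClosed.exists_aeval_eq_zero ℂ q (degree_pos_of_irreducible hq).ne'
  have hint : IsIntegral ℚ α := ⟨q, hm, hα⟩
  obtain rfl := minpoly.eq_of_irreducible_of_monic hq hα hm
  exact ⟨ℚ⟮α⟯, adjoin.finiteDimensional hint, adjoin.finrank hint,
    card_real_embeddings_adjoin_simple hint⟩

/-- The product `(X - 1) (X - 3) ⋯ (X - (2 * s - 1))`. -/
noncomputable def oddProd (s : ℕ) : ℤ[X] := ∏ i ∈ Finset.range s, (X - C (2 * (i : ℤ) + 1))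

theorem monic_oddProd (s : ℕ) : (oddProd s).Monic :=
  monic_prod_of_monic _ _ fun _ _ => monic_X_sub_C _

theorem natDegree_oddProd (s : ℕ) : (oddProd s).natDegree = s := by
  rw [oddProd, natDegree_prod_of_monic _ _ fun i _ => monic_X_sub_C _]
  simp only [natDegree_X_sub_C, Finset.sum_const, Finset.card_range, smul_eq_mul, mul_one]

theorem odd_coeff_zero_oddProd (s : ℕ) : Odd ((oddProd s).coeff 0) := by
  rw [coeff_zero_eq_eval_zero, oddProd, eval_prod]
  refine Finset.prod_induction _ Odd (fun _ _ => Odd.mul) odd_one fun i _ => ?_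
  simp only [eval_sub, eval_X, eval_C, zero_sub]
  exact (odd_two_mul_add_one (i : ℤ)).neg

theorem eval_oddProd_mul_neg {s j : ℕ} (hj : j < s) :
    (oddProd s).eval (2 * (j : ℤ)) * (oddProd s).eval (2 * ((j + 1 : ℕ) : ℤ)) < 0 := by
  rw [oddProd, eval_prod, eval_prod, ← Finset.prod_mul_distrib,
    ← Finset.mul_prod_erase _ _ (Finset.mem_range.2 hj)]
  refine mul_neg_of_neg_of_pos ?_ (Finset.prod_pos fun i hi => ?_)
  · simp only [eval_sub, eval_X, eval_C]
    push_cast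
    ring_nf
    norm_num
  · have hij : (j : ℤ) - i ≠ 0 := by
      have := Finset.ne_of_mem_erase hi
      omega
    have h1 : 1 ≤ ((j : ℤ) - i) ^ 2 := by have := sq_pos_of_ne_zero hij; omega
    simp only [eval_sub, eval_X, eval_C]
    push_cast
    nlinarith

/-- A polynomial that is Eisenstein at `2` and, for suitable `N`, has exactly `s` real roots. -/
noncomputable def eisensteinPoly (s t : ℕ) (N : ℤ) : ℤ[X] :=
  X ^ (s + 2 * t) + C (2 * N) * oddProd s

section eisensteinPoly

variable {s t : ℕ} (N : ℤ)

theorem degree_C_mul_oddProd_lt (ht : 1 ≤ t) :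
    (C (2 * N) * oddProd s).degree < ((s + 2 * t : ℕ) : WithBot ℕ) := by
  refine degree_le_natDegree.trans_lt (Nat.cast_lt.2 ?_)
  have := natDegree_C_mul_le (2 * N) (oddProd s)
  rw [natDegree_oddProd] at this
  omega

theorem monic_eisensteinPoly (ht : 1 ≤ t) : (eisensteinPoly s t N).Monic :=
  monic_X_pow_add (degree_C_mul_oddProd_lt N ht)

theorem natDegree_eisensteinPoly (ht : 1 ≤ t) :
    (eisensteinPoly s t N).natDegree = s + 2 * t :=
  by
  rw [eisensteinPoly, natDegree_add_eq_left_of_degree_lt, natDegree_X_pow]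
  rw [degree_X_pow]
  exact degree_C_mul_oddProd_lt N ht

theorem irreducible_eisensteinPoly (ht : 1 ≤ t) {N : ℤ} (hN : Odd N) :
    Irreducible (eisensteinPoly s t N) := by
  have hprime : (Ideal.span {(2 : ℤ)}).IsPrime :=
    (Ideal.span_singleton_prime two_ne_zero).2 Int.prime_two
  have hm := monic_eisensteinPoly (s := s) N ht
  have hE : (eisensteinPoly s t N).IsEisensteinAt (Ideal.span {(2 : ℤ)}) := by
    refine hm.isEisensteinAt_of_mem_of_notMem hprime.ne_top (fun {n} hn => ?_) ?_
    · rw [natDegree_eisensteinPoly N ht] at hn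
      rw [Ideal.mem_span_singleton, eisensteinPoly, coeff_add, coeff_X_pow, if_neg hn.ne,
        zero_add, coeff_C_mul, mul_assoc]
      exact dvd_mul_right _ _
    · rw [Ideal.span_singleton_pow, Ideal.mem_span_singleton, eisensteinPoly, coeff_add,
        coeff_X_pow, if_neg (by omega), zero_add, coeff_C_mul]
      obtain ⟨k, hk⟩ := hN.mul (odd_coeff_zero_oddProd s)
      rw [mul_assoc, hk]
      omega
  refine hE.irreducible hprime hm.isPrimitive ?_
  rw [natDegree_eisensteinPoly N ht]
  omega

theorem iterate_derivative_eisensteinPoly :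
    derivative^[s] (eisensteinPoly s t N) =
      C ((s + 2 * t).descFactorial s : ℤ) * X ^ (2 * t) + C (2 * N * s.factorial) := by
  have h : derivative^[s] (oddProd s) = C (s.factorial : ℤ) := by
    rw [eq_C_of_natDegree_le_zero ((natDegree_iterate_derivative _ s).trans
      (by rw [natDegree_oddProd, Nat.sub_self])), coeff_iterate_derivative, zero_add,
      Nat.descFactorial_self]
    have : (oddProd s).coeff s = 1 := by
      simpa [natDegree_oddProd] using (monic_oddProd s).coeff_natDegree
    simp [this]
  rw [eisensteinPoly, iterate_map_add, iterate_derivative_C_mul, h,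
    iterate_derivative_X_pow_eq_C_mul, Nat.add_sub_cancel_left]
  simp

theorem card_realRoots_eisensteinPoly_le {N : ℤ} (hN : 0 < N) :
    ((eisensteinPoly s t N).map (Int.castRingHom ℝ)).roots.toFinset.card ≤ s := by
  refine (card_roots_toFinset_le_iterate_derivative _ s).trans ?_
  rw [iterate_derivative_map, iterate_derivative_eisensteinPoly]
  suffices h : (Polynomial.map (Int.castRingHom ℝ) (C ((s + 2 * t).descFactorial s : ℤ) *
      X ^ (2 * t) + C (2 * N * s.factorial))).roots = 0 by rw [h]; simp
  refine Multiset.eq_zero_of_forall_notMem fun x hx => ?_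
  have h0 := isRoot_of_mem_roots hx
  have h1 : (0 : ℝ) < 2 * N * s.factorial := by positivity
  have h2 : (0 : ℝ) ≤ (s + 2 * t).descFactorial s * x ^ (2 * t) :=
    mul_nonneg (Nat.cast_nonneg _) (by rw [pow_mul]; positivity)
  simp only [IsRoot.def, eval_map, eval₂_add, eval₂_mul, eval₂_C, eval₂_X_pow] at h0
  simp only [eq_intCast, Int.cast_mul, Int.cast_natCast, Int.cast_ofNat] at h0
  linarith

theorem eval_eisensteinPoly_mul_neg {N : ℤ} (hN : (2 * (s : ℤ)) ^ (s + 2 * t) < N) {j : ℕ}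
    (hj : j < s) :
    (eisensteinPoly s t N).eval (2 * (j : ℤ)) *
      (eisensteinPoly s t N).eval (2 * ((j + 1 : ℕ) : ℤ)) < 0 := by
  have hbound (i : ℕ) (hi : i ≤ s) : (2 * (i : ℤ)) ^ (s + 2 * t) < N :=
    (pow_le_pow_left₀ (by positivity) (by gcongr) _).trans_lt hN
  have ha := hbound j hj.le
  have hb := hbound (j + 1) hj
  have ha0 : 0 ≤ (2 * (j : ℤ)) ^ (s + 2 * t) := by positivity
  have hb0 : 0 ≤ (2 * ((j + 1 : ℕ) : ℤ)) ^ (s + 2 * t) := by positivity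
  have hN0 : 0 < N := ha0.trans_lt ha
  simp only [eisensteinPoly, eval_add, eval_pow, eval_X, eval_mul, eval_C]
  rcases mul_neg_iff.1 (eval_oddProd_mul_neg hj) with ⟨h₁, h₂⟩ | ⟨h₁, h₂⟩
  · exact mul_neg_of_pos_of_neg (by positivity) (by nlinarith)
  · exact mul_neg_of_neg_of_pos (by nlinarith) (by positivity)

theorem card_realRoots_eisensteinPoly (ht : 1 ≤ t) {N : ℤ}
    (hN : (2 * (s : ℤ)) ^ (s + 2 * t) < N) :
    ((eisensteinPoly s t N).map (Int.castRingHom ℝ)).roots.toFinset.card = s := by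
  have hN0 : 0 < N := lt_of_le_of_lt (by positivity) hN
  refine (card_realRoots_eisensteinPoly_le hN0).antisymm ?_
  refine le_card_roots_toFinset_of_eval_mul_eval_neg
    ((monic_eisensteinPoly N ht).map _).ne_zero
    (x := fun j => ((2 * (j : ℤ) : ℤ) : ℝ)) (fun i j hij => ?_) fun j hj => ?_
  · simp only [Int.cast_le]
    gcongr
  · simp only [eval_intCast_map, eq_intCast]
    exact_mod_cast eval_eisensteinPoly_mul_neg hN hj

end eisensteinPoly

/-- For every pair of integers `s ≥ 1` and `t ≥ 1` there exists an algebraic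
number field `K` (a finite extension of `ℚ`, here realized as an intermediate field
`ℚ ⊆ K ⊆ ℂ`) of degree `s + 2t` over `ℚ` admitting exactly `s` real embeddings into `ℂ`
(embeddings whose image lies in `ℝ`) and exactly `2t` non-real complex embeddings. -/
theorem exists_numberField_with_s_real_and_2t_complex_embeddings
    (s t : ℕ) (hs : 1 ≤ s) (ht : 1 ≤ t) :
    ∃ K : IntermediateField ℚ ℂ,
      FiniteDimensional ℚ K ∧
      Module.finrank ℚ K = s + 2 * t ∧
      Nat.card {φ : K →+* ℂ // ∀ x : K, (φ x).im = 0} = s ∧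
      Nat.card {φ : K →+* ℂ // ¬ ∀ x : K, (φ x).im = 0} = 2 * t := by
  set N : ℤ := 2 * (2 * (s : ℤ)) ^ (s + 2 * t) + 1
  have hN : (2 * (s : ℤ)) ^ (s + 2 * t) < N := by
    have : 0 ≤ (2 * (s : ℤ)) ^ (s + 2 * t) := by positivity
    omega
  have hm := monic_eisensteinPoly (s := s) N ht
  obtain ⟨K, hfin, hrank, hreal⟩ := exists_intermediateField_of_irreducible
    (hm.irreducible_iff_irreducible_map_fraction_map.1
      (irreducible_eisensteinPoly ht (odd_two_mul_add_one _)))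
    (hm.map (algebraMap ℤ ℚ))
  rw [hm.natDegree_map, natDegree_eisensteinPoly N ht] at hrank
  rw [aroots_map, aroots_def, algebraMap_int_eq, card_realRoots_eisensteinPoly ht hN] at hreal
  refine ⟨K, hfin, hrank, hreal, ?_⟩
  have : NumberField K := ⟨⟩
  have hsum : Nat.card (K →+* ℂ) = s + 2 * t := by
    rw [Nat.card_eq_fintype_card, NumberField.Embeddings.card, hrank]
  classical
  rw [← Nat.card_congr (Equiv.sumCompl fun φ : K →+* ℂ => ∀ x : K, (φ x).im = 0),
    Nat.card_sum, hreal] at hsum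
  omega
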